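/- Let u, v be nonzero real numbers and define the matrix-valued map G_{u,v} : ℝ⁴ → (4×4 real symmetric matrices) in coordinates (x,y,z,t) by (G_{u,v})_xx = −v t², (G_{u,v})_xt = (G_{u,v})_tx = v, (G_{u,v})_yy = −u z², (G_{u,v})_yz = (G_{u,v})_zy = u, and all other entries zero (encoding G_{u,v} = −v t² dx² + 2v dt dx − u z² dy² + 2u dz dy). Then the coordinate Ricci tensor of G_{u,v} satisfies Ric_{ij} = −(G_{u,v})_{ij} at every point of ℝ⁴ if and only if u = 1 and v = 1. -/

import Mathlib

open Matrix

/-- Partial derivative in the `i`-th coordinate direction of a function on `ℝ⁴`. -/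
noncomputable def pd (i : Fin 4) (f : (Fin 4 → ℝ) → ℝ) (x : Fin 4 → ℝ) : ℝ :=
  fderiv ℝ f x (Pi.single i 1)

/-- Christoffel symbols `Γ^k_{ij}` of a matrix-valued map `g` on `ℝ⁴`. -/
noncomputable def christoffel (g : (Fin 4 → ℝ) → Matrix (Fin 4) (Fin 4) ℝ)
    (k i j : Fin 4) (x : Fin 4 → ℝ) : ℝ :=
  (1 / 2) * ∑ l, (g x)⁻¹ k l *
    (pd i (fun y => g y l j) x + pd j (fun y => g y l i) x - pd l (fun y => g y i j) x)

/-- Coordinate Ricci tensor `Ric_{ij}` of a matrix-valued map `g` on `ℝ⁴`. -/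
noncomputable def ricci (g : (Fin 4 → ℝ) → Matrix (Fin 4) (Fin 4) ℝ)
    (i j : Fin 4) (x : Fin 4 → ℝ) : ℝ :=
  (∑ k, pd k (christoffel g k i j) x) - (∑ k, pd j (christoffel g k i k) x)
    + ∑ k, ∑ l, (christoffel g k k l x * christoffel g l i j x
        - christoffel g k j l x * christoffel g l i k x)

theorem pd_of (f : (Fin 4 → ℝ) → ℝ) (x : Fin 4 → ℝ) (f' : (Fin 4 → ℝ) →L[ℝ] ℝ)
    (h : HasFDerivAt f f' x) (i : Fin 4) : pd i f x = f' (Pi.single i 1) := by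
  unfold pd; rw [h.fderiv]

theorem pd_const (c : ℝ) (i : Fin 4) (x : Fin 4 → ℝ) : pd i (fun _ => c) x = 0 := by
  simp [pd]

theorem pd_mono (c : ℝ) (n : ℕ) (m i : Fin 4) (x : Fin 4 → ℝ) :
    pd i (fun y => c * y m ^ n) x = c * (n * x m ^ (n - 1)) * (if i = m then 1 else 0) := by
  have h := (((hasFDerivAt_apply (𝕜 := ℝ) m x).pow n).const_mul c)
  rw [pd_of _ _ _ h]
  by_cases him : i = m
  · subst him; simp
  · simp [him, Ne.symm him]

theorem pd_id (m i : Fin 4) (x : Fin 4 → ℝ) :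
    pd i (fun y => y m) x = if i = m then 1 else 0 := by
  have h := pd_mono 1 1 m i x
  simpa using h

theorem pd_neg_id (m i : Fin 4) (x : Fin 4 → ℝ) :
    pd i (fun y => - y m) x = if i = m then -1 else 0 := by
  have h := pd_mono (-1) 1 m i x
  simp only [pow_one, neg_mul, one_mul] at h
  rw [h]; split_ifs <;> simp

theorem pd_cube (m i : Fin 4) (x : Fin 4 → ℝ) :
    pd i (fun y => y m ^ 3) x = if i = m then 3 * x m ^ 2 else 0 := by
  have h := pd_mono 1 3 m i x
  simpa using h

/-- The Christoffel symbols in closed form. -/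
def chr (k i j : Fin 4) (p : Fin 4 → ℝ) : ℝ :=
  (![![![1 * p 3 ^ 1, 0, 0, 0], ![0, 0, 0, 0], ![0, 0, 0, 0], ![0, 0, 0, 0]],
     ![![0, 0, 0, 0], ![0, 1 * p 2 ^ 1, 0, 0], ![0, 0, 0, 0], ![0, 0, 0, 0]],
     ![![0, 0, 0, 0], ![0, 1 * p 2 ^ 3, (-1) * p 2 ^ 1, 0], ![0, (-1) * p 2 ^ 1, 0, 0], ![0, 0, 0, 0]],
     ![![1 * p 3 ^ 3, 0, 0, (-1) * p 3 ^ 1], ![0, 0, 0, 0], ![0, 0, 0, 0], ![(-1) * p 3 ^ 1, 0, 0, 0]]]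
     : Fin 4 → Fin 4 → Fin 4 → ℝ) k i j

theorem inv_G (u v a b : ℝ) (hu : u ≠ 0) (hv : v ≠ 0) :
    (!![-(v * a ^ 2), 0, 0, v; 0, -(u * b ^ 2), u, 0; 0, u, 0, 0; v, 0, 0, 0]
      : Matrix (Fin 4) (Fin 4) ℝ)⁻¹
    = !![0, 0, 0, 1 / v; 0, 0, 1 / u, 0; 0, 1 / u, b ^ 2 / u, 0; 1 / v, 0, 0, a ^ 2 / v] := by
  apply Matrix.inv_eq_right_inv
  ext i j
  fin_cases i <;> fin_cases j <;> simp [Matrix.mul_apply, Fin.sum_univ_four] <;> field_simp <;> simp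

theorem chr_eq (u v : ℝ) (hu : u ≠ 0) (hv : v ≠ 0)
    (G : (Fin 4 → ℝ) → Matrix (Fin 4) (Fin 4) ℝ)
    (hG : ∀ p : Fin 4 → ℝ,
      G p = !![-(v * p 3 ^ 2), 0, 0, v;
               0, -(u * p 2 ^ 2), u, 0;
               0, u, 0, 0;
               v, 0, 0, 0]) (k i j : Fin 4) : christoffel G k i j = chr k i j := by
  funext p
  have hd : ∀ l a b : Fin 4, pd l (fun y => G y a b) p =
      if a = 0 ∧ b = 0 ∧ l = 3 then -2 * v * p 3 else
      if a = 1 ∧ b = 1 ∧ l = 2 then -2 * u * p 2 else 0 := by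
    intro l a b
    have h3 := pd_mono (-v) 2 3 l p
    have h2 := pd_mono (-u) 2 2 l p
    simp only [neg_mul] at h3 h2
    fin_cases a <;> fin_cases b <;> simp [hG, pd_const, h2, h3] <;>
      split_ifs <;> ring
  simp only [christoffel, hd]
  simp only [hG, inv_G u v _ _ hu hv, Fin.sum_univ_four]
  fin_cases k <;> fin_cases i <;> fin_cases j <;> simp [chr] <;> field_simp

theorem ricci_eq (u v : ℝ) (hu : u ≠ 0) (hv : v ≠ 0)
    (G : (Fin 4 → ℝ) → Matrix (Fin 4) (Fin 4) ℝ)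
    (hG : ∀ p : Fin 4 → ℝ,
      G p = !![-(v * p 3 ^ 2), 0, 0, v;
               0, -(u * p 2 ^ 2), u, 0;
               0, u, 0, 0;
               v, 0, 0, 0]) (i j : Fin 4) (p : Fin 4 → ℝ) : ricci G i j p =
      - (!![-(p 3 ^ 2), 0, 0, 1; 0, -(p 2 ^ 2), 1, 0; 0, 1, 0, 0; 1, 0, 0, 0]
        : Matrix (Fin 4) (Fin 4) ℝ) i j := by
  have e : ∀ k i j, christoffel G k i j = fun p => chr k i j p := chr_eq u v hu hv G hG
  simp only [ricci, e, Fin.sum_univ_four]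
  fin_cases i <;> fin_cases j <;>
    simp [chr, pd_const, pd_id, pd_neg_id, pd_cube] <;> ring

/-- The metric `G_{u,v} = −v t² dx² + 2v dt dx − u z² dy² + 2u dz dy`, with coordinates
`(x,y,z,t) = (p 0, p 1, p 2, p 3)` and `u, v ≠ 0`, satisfies the Einstein condition
`Ric = −G_{u,v}` at every point if and only if `u = 1` and `v = 1`. -/
theorem einstein_condition_forces_u_v_one
    (u v : ℝ) (hu : u ≠ 0) (hv : v ≠ 0)
    (G : (Fin 4 → ℝ) → Matrix (Fin 4) (Fin 4) ℝ)
    (hG : ∀ p : Fin 4 → ℝ,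
      G p = !![-(v * p 3 ^ 2), 0, 0, v;
               0, -(u * p 2 ^ 2), u, 0;
               0, u, 0, 0;
               v, 0, 0, 0]) :
    (∀ p : Fin 4 → ℝ, ∀ i j : Fin 4, ricci G i j p = -(G p i j)) ↔ (u = 1 ∧ v = 1) := by
  constructor
  · intro h
    have h1 := h 0 1 2
    have h2 := h 0 0 3
    rw [ricci_eq u v hu hv G hG, hG] at h1 h2
    simp at h1 h2
    exact ⟨h1.symm, h2.symm⟩
  · rintro ⟨rfl, rfl⟩ p i j
    rw [ricci_eq 1 1 hu hv G hG, hG]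
    simp
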